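/- arXiv:2408.04265 — 5 statements merged into one kernel-verified Lean document; each statement's English description precedes it below -/
import Mathlib

section
/- A group G is a Wirtinger group if and only if the abelianization G_ab is free abelian and there exists a subset B ⊆ G satisfying: (1) G coincides with the normal closure of B; (2) the classes in G_ab of the elements of B are linearly independent; (3) every class in H₂G can be written as a finite sum Σ_{a∈B} cls([a|g_a] − [g_a|a]) where, for each a in a finite subset of B, g_a is an element of the centralizer C_G(a) of a in G (equivalently, the homomorphism ζ : ⊕_{a∈B} C_G(a) → H₂G sending (g_a)_{a∈B} to Σ_{a∈B} [a|g_a] − [g_a|a] is surjective). -/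
open Finsupp

noncomputable section

universe u

/-- Degree-2 differential of the (unnormalized) inhomogeneous bar complex of `G`
with trivial `ℤ` coefficients: `[g|h] ↦ [h] - [gh] + [g]`. -/
def d2 (G : Type*) [Group G] : ((G × G) →₀ ℤ) →ₗ[ℤ] (G →₀ ℤ) :=
  Finsupp.lift _ ℤ _ fun p => single p.2 1 - single (p.1 * p.2) 1 + single p.1 1

/-- Degree-3 differential: `[g|h|k] ↦ [h|k] - [gh|k] + [g|hk] - [g|h]`. -/
def d3 (G : Type*) [Group G] : ((G × G × G) →₀ ℤ) →ₗ[ℤ] ((G × G) →₀ ℤ) :=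
  Finsupp.lift _ ℤ _ fun t =>
    single (t.2.1, t.2.2) 1 - single (t.1 * t.2.1, t.2.2) 1 +
      single (t.1, t.2.1 * t.2.2) 1 - single (t.1, t.2.1) 1

/-- 2-cycles. -/
def Z2 (G : Type*) [Group G] : Submodule ℤ ((G × G) →₀ ℤ) := LinearMap.ker (d2 G)

/-- 2-boundaries, as a submodule of the 2-cycles. -/
def B2 (G : Type*) [Group G] : Submodule ℤ (Z2 G) :=
  (LinearMap.range (d3 G)).comap (Z2 G).subtype

/-- The second integral homology of `G`, defined via the inhomogeneous bar complex. -/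
abbrev H2 (G : Type*) [Group G] := Z2 G ⧸ B2 G

/-- The homology class of a 2-cycle. -/
def H2cls (G : Type*) [Group G] (z : (G × G) →₀ ℤ) (hz : z ∈ Z2 G) : H2 G :=
  Submodule.Quotient.mk ⟨z, hz⟩

/-- The bar 2-chain `[a|g] - [g|a]`. -/
def barChain (G : Type*) [Group G] (a g : G) : (G × G) →₀ ℤ :=
  single (a, g) 1 - single (g, a) 1

theorem barChain_mem (G : Type*) [Group G] (a g : G) (h : a * g = g * a) :
    barChain G a g ∈ Z2 G := by
  simp only [Z2, LinearMap.mem_ker, barChain, map_sub, d2, Finsupp.lift_apply]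
  rw [sum_single_index, sum_single_index] <;>
    simp [h, sub_add_eq_sub_sub]
  abel

/-- The homology class of the 2-cycle `[a|g] - [g|a]` (defined to be `0` if `a` and `g`
do not commute). -/
def barCls (G : Type*) [Group G] (a g : G) : H2 G :=
  open scoped Classical in
  if h : a * g = g * a then H2cls G (barChain G a g) (barChain_mem G a g h) else 0

/-- `r` is a Wirtinger relator: it has the form `x_β⁻¹ x_α x_β x_γ⁻¹` for generators
`x_α, x_β, x_γ`. -/
def IsWirtingerRelator {X : Type*} (r : FreeGroup X) : Prop :=
  ∃ α β γ : X,
    r = (FreeGroup.of β)⁻¹ * FreeGroup.of α * FreeGroup.of β * (FreeGroup.of γ)⁻¹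

/-- A group is a Wirtinger group if it admits a presentation all of whose defining
relations have the form `x_β⁻¹ x_α x_β = x_γ`. -/
def IsWirtingerGroup (G : Type u) [Group G] : Prop :=
  ∃ (X : Type u) (rels : Set (FreeGroup X)),
    (∀ r ∈ rels, IsWirtingerRelator r) ∧ Nonempty (G ≃* PresentedGroup rels)

/-! ### Characters -/

theorem CharacterModule.exists_extension {A B : Type*} [AddCommGroup A] [AddCommGroup B]
    (f : A →ₗ[ℤ] B) (χ : CharacterModule A) (h : ∀ a, f a = 0 → χ a = 0) :
    ∃ ψ : CharacterModule B, ∀ a, ψ (f a) = χ a := by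
  let χ' : A →+ AddCircle (1 : ℚ) := χ
  let g : A ⧸ LinearMap.ker f →ₗ[ℤ] AddCircle (1 : ℚ) :=
    (LinearMap.ker f).liftQ χ'.toIntLinearMap fun a ha => h a ha
  obtain ⟨ψ, hψ⟩ := CharacterModule.dual_surjective_of_injective
    ((LinearMap.ker f).liftQ f le_rfl)
    (LinearMap.ker_eq_bot.1 (Submodule.ker_liftQ_eq_bot _ _ _ le_rfl))
    (g.toAddMonoidHom : CharacterModule (A ⧸ LinearMap.ker f))
  exact ⟨ψ, fun a => DFunLike.congr_fun hψ (Submodule.Quotient.mk a)⟩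

theorem CharacterModule.exists_ne_zero_of_notMem {A : Type*} [AddCommGroup A]
    (S : Submodule ℤ A) {a : A} (ha : a ∉ S) :
    ∃ χ : CharacterModule A, (∀ s ∈ S, χ s = 0) ∧ χ a ≠ 0 := by
  have hne : (Submodule.Quotient.mk a : A ⧸ S) ≠ 0 := by
    rwa [Ne, Submodule.Quotient.mk_eq_zero]
  obtain ⟨c, hc⟩ := CharacterModule.exists_character_apply_ne_zero_of_ne_zero hne
  let c' : A ⧸ S →+ AddCircle (1 : ℚ) := c
  refine ⟨(c'.comp S.mkQ.toAddMonoidHom : A →+ AddCircle (1 : ℚ)), fun s hs => ?_, hc⟩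
  have : (Submodule.Quotient.mk s : A ⧸ S) = 0 := (Submodule.Quotient.mk_eq_zero S).2 hs
  change c' (Submodule.Quotient.mk s) = 0
  rw [this, map_zero]

/-! ### The bar complex -/

section Bar

variable {G : Type*} [Group G]

theorem d2_single (g h : G) :
    d2 G (single (g, h) 1) = single h 1 - single (g * h) 1 + single g 1 := by
  simp [d2]

theorem d3_single (g h k : G) :
    d3 G (single (g, h, k) 1) =
      single (h, k) 1 - single (g * h, k) 1 + single (g, h * k) 1 - single (g, h) 1 := by
  simp [d3]

theorem d2_comp_d3 (x : (G × G × G) →₀ ℤ) : d2 G (d3 G x) = 0 := by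
  have : (d2 G).comp (d3 G) = 0 := by
    ext ⟨g, h, k⟩ : 2
    ext : 1
    simp only [LinearMap.comp_apply, Finsupp.lsingle_apply, d3_single, map_sub, map_add, d2_single,
      mul_assoc, LinearMap.zero_apply]
    abel
  exact DFunLike.congr_fun this x

theorem H2cls_eq_of_sub_eq_d3 {z w : (G × G) →₀ ℤ} (hz : z ∈ Z2 G) (hw : w ∈ Z2 G)
    (x : (G × G × G) →₀ ℤ) (h : z - w = d3 G x) : H2cls G z hz = H2cls G w hw :=
  (Submodule.Quotient.eq _).2 ⟨x, h.symm⟩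

theorem H2cls_surjective (h : H2 G) : ∃ z hz, H2cls G z hz = h := by
  obtain ⟨⟨z, hz⟩, rfl⟩ := Submodule.Quotient.mk_surjective _ h
  exact ⟨z, hz, rfl⟩

theorem barCls_of_comm {a g : G} (h : a * g = g * a) :
    barCls G a g = H2cls G (barChain G a g) (barChain_mem G a g h) :=
  dif_pos h

theorem barCls_mul {a g h : G} (hg : a * g = g * a) (hh : a * h = h * a) :
    barCls G a (g * h) = barCls G a g + barCls G a h := by
  have hgh : a * (g * h) = g * h * a := by rw [← mul_assoc, hg, mul_assoc, hh, mul_assoc]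
  rw [barCls_of_comm hg, barCls_of_comm hh, barCls_of_comm hgh]
  refine H2cls_eq_of_sub_eq_d3 _
    (Submodule.add_mem _ (barChain_mem G a g hg) (barChain_mem G a h hh))
    (single (a, g, h) 1 - single (g, a, h) 1 + single (g, h, a) 1) ?_
  simp only [barChain, map_sub, map_add, d3_single, hg, hh]
  abel

theorem barCls_one (a : G) : barCls G a 1 = 0 := by
  have h : a * 1 = 1 * a := by simp
  simpa using barCls_mul h h

/-- The classes of the cycles `[a|g] - [g|a]` with `g ∈ C_G(a)`. -/
def barImage (a : G) : Submodule ℤ (H2 G) :=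
  AddSubgroup.toIntSubmodule
    { carrier := {h | ∃ g, a * g = g * a ∧ barCls G a g = h}
      zero_mem' := ⟨1, by simp, barCls_one a⟩
      add_mem' := by
        rintro _ _ ⟨g, hg, rfl⟩ ⟨h, hh, rfl⟩
        exact ⟨g * h, (Commute.mul_right hg hh), barCls_mul hg hh⟩
      neg_mem' := by
        rintro _ ⟨g, hg, rfl⟩
        have hg' : a * g⁻¹ = g⁻¹ * a := Commute.inv_right hg
        refine ⟨g⁻¹, hg', eq_neg_of_add_eq_zero_left ?_⟩
        rw [← barCls_mul hg' hg, inv_mul_cancel, barCls_one] }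

/-- The subgroup of `H₂ G` generated by the classes of `[a|g] - [g|a]` with `a ∈ B` and
`g ∈ C_G(a)`. -/
def barSpan (B : Set G) : Submodule ℤ (H2 G) := ⨆ a : B, barImage (a : G)

theorem barCls_mem_barSpan {B : Set G} {a g : G} (ha : a ∈ B) (h : a * g = g * a) :
    barCls G a g ∈ barSpan B :=
  Submodule.mem_iSup_of_mem (p := fun a : B => barImage (a : G)) ⟨a, ha⟩ ⟨g, h, rfl⟩

theorem exists_sum_barCls_of_mem_barSpan {B : Set G} {h : H2 G} (hh : h ∈ barSpan B) :
    ∃ (s : Finset B) (gfam : B → G),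
      (∀ a ∈ s, gfam a ∈ Subgroup.centralizer {(a : G)}) ∧
      h = ∑ a ∈ s, barCls G (a : G) (gfam a) := by
  obtain ⟨f, hf, rfl⟩ :=
    (Submodule.mem_iSup_iff_exists_finsupp (fun a : B => barImage (a : G)) h).1 hh
  choose g hg hgf using hf
  refine ⟨f.support, g, fun a _ => Subgroup.mem_centralizer_singleton_iff.2 (hg a).symm, ?_⟩
  exact Finset.sum_congr rfl fun a _ => (hgf a).symm

/-- A character of 2-chains vanishing on boundaries and on the cycles `[a|g] - [g|a]` for `a ∈ B`
vanishes on all cycles as soon as these cycles generate `H₂ G`. -/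
theorem character_eq_zero_of_barSpan {B : Set G} (F : CharacterModule ((G × G) →₀ ℤ))
    (hF3 : ∀ x, F (d3 G x) = 0)
    (hFB : ∀ a ∈ B, ∀ g, a * g = g * a → F (barChain G a g) = 0)
    (hB : ∀ h : H2 G, ∃ (s : Finset B) (gfam : B → G),
      (∀ a ∈ s, gfam a ∈ Subgroup.centralizer {(a : G)}) ∧
      h = ∑ a ∈ s, barCls G (a : G) (gfam a)) (z : (G × G) →₀ ℤ) (hz : d2 G z = 0) :
    F z = 0 := by
  let F' : ((G × G) →₀ ℤ) →+ AddCircle (1 : ℚ) := F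
  let φ : H2 G →ₗ[ℤ] AddCircle (1 : ℚ) :=
    (B2 G).liftQ (F'.toIntLinearMap.comp (Z2 G).subtype) (by
      rintro ⟨w, hw⟩ ⟨x, rfl⟩
      exact hF3 x)
  obtain ⟨s, g, hg, hs⟩ := hB (H2cls G z hz)
  change φ (H2cls G z hz) = 0
  rw [hs, map_sum]
  refine Finset.sum_eq_zero fun a ha => ?_
  have hc := (Subgroup.mem_centralizer_singleton_iff.1 (hg a ha)).symm
  rw [barCls_of_comm hc]
  exact hFB a a.2 _ hc

end Bar

/-! ### Central extensions from 2-cocycles -/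

/-- A 2-cocycle with trivial coefficients, not assumed to be normalized. -/
structure TwoCocycle (G A : Type*) [Group G] [AddCommGroup A] where
  /-- The underlying function. -/
  toFun : G → G → A
  cocycle : ∀ g h k, toFun h k - toFun (g * h) k + toFun g (h * k) - toFun g h = 0

namespace TwoCocycle

variable {G A : Type*} [Group G] [AddCommGroup A] (f : TwoCocycle G A)

theorem one_left (k : G) : f.toFun 1 k = f.toFun 1 1 := by
  simpa [sub_eq_zero] using f.cocycle 1 1 k

theorem add_eq (g h k : G) :
    f.toFun g h + f.toFun (g * h) k = f.toFun g (h * k) + f.toFun h k := by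
  rw [← sub_eq_zero, ← neg_eq_zero, ← f.cocycle g h k]
  abel

/-- The extension of `G` by `A` determined by a 2-cocycle. -/
@[ext]
structure Extension (f : TwoCocycle G A) where
  /-- The component in `G`. -/
  fst : G
  /-- The component in `A`. -/
  snd : A

namespace Extension

instance : Mul f.Extension := ⟨fun x y => ⟨x.fst * y.fst, x.snd + y.snd + f.toFun x.fst y.fst⟩⟩

instance : One f.Extension := ⟨⟨1, -f.toFun 1 1⟩⟩

instance : Inv f.Extension :=
  ⟨fun x => ⟨x.fst⁻¹, -x.snd - f.toFun x.fst⁻¹ x.fst - f.toFun 1 1⟩⟩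

variable {f}

@[simp] theorem mul_fst (x y : f.Extension) : (x * y).fst = x.fst * y.fst := rfl

theorem mul_snd (x y : f.Extension) :
    (x * y).snd = x.snd + y.snd + f.toFun x.fst y.fst := rfl

@[simp] theorem one_fst : (1 : f.Extension).fst = 1 := rfl

theorem one_snd : (1 : f.Extension).snd = -f.toFun 1 1 := rfl

@[simp] theorem inv_fst (x : f.Extension) : x⁻¹.fst = x.fst⁻¹ := rfl

theorem inv_snd (x : f.Extension) :
    x⁻¹.snd = -x.snd - f.toFun x.fst⁻¹ x.fst - f.toFun 1 1 := rfl

instance : Group f.Extension :=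
  Group.ofLeftAxioms
    (fun x y z => by
      ext
      · simp [mul_assoc]
      · have := f.add_eq x.fst y.fst z.fst
        simp only [mul_snd, mul_fst]
        rw [← sub_eq_zero] at this ⊢
        rw [← this]
        abel)
    (fun x => by
      ext
      · simp
      · simp only [mul_snd, one_fst, one_snd, f.one_left]
        abel)
    (fun x => by
      ext
      · simp
      · simp only [mul_snd, inv_fst, inv_snd, one_snd]
        abel)

variable (f) in
/-- The projection of the extension to `G`. -/
def proj : f.Extension →* G where
  toFun := fst
  map_one' := rfl
  map_mul' _ _ := rfl

theorem mul_comm_of_fst {x y : f.Extension} (h : x.fst * y.fst = y.fst * x.fst)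
    (hf : f.toFun x.fst y.fst = f.toFun y.fst x.fst) : x * y = y * x := by
  ext
  · exact h
  · rw [mul_snd, mul_snd, hf, add_comm x.snd]

end Extension

end TwoCocycle

/-- If `s` is a section of the extension, then the cocycle is a coboundary. -/
theorem TwoCocycle.character_eq_zero_of_section {G : Type*} [Group G]
    (F : CharacterModule ((G × G) →₀ ℤ)) (f : TwoCocycle G (AddCircle (1 : ℚ)))
    (hF : ∀ g h, F (single (g, h) 1) = f.toFun g h) (s : G →* f.Extension)
    (hs : ∀ g, (s g).fst = g) (z : (G × G) →₀ ℤ) (hz : d2 G z = 0) : F z = 0 := by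
  let F' : ((G × G) →₀ ℤ) →+ AddCircle (1 : ℚ) := F
  let c : (G →₀ ℤ) →ₗ[ℤ] AddCircle (1 : ℚ) := Finsupp.lift _ ℤ _ fun g => -(s g).snd
  have hc : ∀ g, c (single g 1) = -(s g).snd := fun g => by simp [c]
  have key : F'.toIntLinearMap = c.comp (d2 G) := by
    ext ⟨g, h⟩
    have hgh := TwoCocycle.Extension.mul_snd (s g) (s h)
    rw [← map_mul, hs, hs, ← hF] at hgh
    simp only [LinearMap.comp_apply, Finsupp.lsingle_apply, d2_single, map_sub, map_add, hc, hgh]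
    change F (single (g, h) 1) = _
    abel
  calc F z = c (d2 G z) := DFunLike.congr_fun key z
    _ = 0 := by rw [hz, map_zero]

/-! ### Wirtinger groups satisfy the homological conditions -/

namespace IsWirtingerGroup

/-- Two generators are related if one relation of a Wirtinger presentation identifies one with
a conjugate of the other. -/
def ConjRel {X : Type*} (rels : Set (FreeGroup X)) (x y : X) : Prop :=
  ∃ b, (FreeGroup.of b)⁻¹ * FreeGroup.of x * FreeGroup.of b * (FreeGroup.of y)⁻¹ ∈ rels

section

variable {X : Type*} {rels : Set (FreeGroup X)} {G : Type*} [Group G]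
  (e : PresentedGroup rels ≃* G)

/-- The image in `G` of a generator of the presentation. -/
def gen (x : X) : G := e (PresentedGroup.of x)

theorem closure_range_gen : Subgroup.closure (Set.range (gen e)) = ⊤ := by
  have : Set.range (gen e) = Set.image e.toMonoidHom (Set.range PresentedGroup.of) := by
    rw [← Set.range_comp]; rfl
  rw [this, ← MonoidHom.map_closure, PresentedGroup.closure_range_of, ← MonoidHom.range_eq_map,
    MonoidHom.range_eq_top]
  exact e.surjective

theorem lift_eq_one_iff {E : Type*} [Group E] (t : X → E) (x b y : X) :
    FreeGroup.lift t ((FreeGroup.of b)⁻¹ * FreeGroup.of x * FreeGroup.of b *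
      (FreeGroup.of y)⁻¹) = 1 ↔ (t b)⁻¹ * t x * t b = t y := by
  simp [mul_inv_eq_one]

theorem gen_conj {x b y : X}
    (h : (FreeGroup.of b)⁻¹ * FreeGroup.of x * FreeGroup.of b * (FreeGroup.of y)⁻¹ ∈ rels) :
    (gen e b)⁻¹ * gen e x * gen e b = gen e y := by
  have := PresentedGroup.one_of_mem h
  rw [map_mul, map_mul, map_mul, map_inv, map_inv, mul_inv_eq_one] at this
  simpa [gen] using! congrArg e this

theorem isConj_of_mk_eq {x y : X} (h : Quot.mk (ConjRel rels) x = Quot.mk (ConjRel rels) y) :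
    IsConj (gen e x) (gen e y) := by
  induction Quot.eqvGen_exact h with
  | rel x y hxy =>
    obtain ⟨b, hb⟩ := hxy
    refine isConj_iff.2 ⟨(gen e b)⁻¹, ?_⟩
    rw [inv_inv, gen_conj e hb]
  | refl x => exact IsConj.refl _
  | symm x y hxy ih => exact (ih (Quot.eqvGen_sound hxy)).symm
  | trans x y z hxy hyz ih₁ ih₂ =>
    exact (ih₁ (Quot.eqvGen_sound hxy)).trans (ih₂ (Quot.eqvGen_sound hyz))

/-- The chosen representative generator of a class of generators. -/
def rep (c : Quot (ConjRel rels)) : G := gen e c.out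

theorem exists_conj_rep (x : X) : ∃ g : G, g⁻¹ * rep e (Quot.mk _ x) * g = gen e x := by
  obtain ⟨g, hg⟩ := isConj_iff.1 (isConj_of_mk_eq e (Quot.out_eq (Quot.mk (ConjRel rels) x)))
  exact ⟨g⁻¹, by rwa [inv_inv]⟩

theorem normalClosure_range_rep : Subgroup.normalClosure (Set.range (rep e)) = ⊤ := by
  rw [eq_top_iff, ← closure_range_gen e, Subgroup.closure_le]
  rintro _ ⟨x, rfl⟩
  obtain ⟨g, hg⟩ := exists_conj_rep e x
  rw [SetLike.mem_coe, ← hg]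
  have hn : (Subgroup.normalClosure (Set.range (rep e))).Normal := inferInstance
  simpa using hn.conj_mem _ (Subgroup.subset_normalClosure ⟨Quot.mk _ x, rfl⟩) g⁻¹

theorem exists_hom (hrels : ∀ r ∈ rels, IsWirtingerRelator r) {E : Type*} [Group E] (t : X → E)
    (ht : ∀ x b y,
      (FreeGroup.of b)⁻¹ * FreeGroup.of x * FreeGroup.of b * (FreeGroup.of y)⁻¹ ∈ rels →
        (t b)⁻¹ * t x * t b = t y) :
    ∃ φ : G →* E, ∀ x, φ (gen e x) = t x := by
  have h : ∀ r ∈ rels, FreeGroup.lift t r = 1 := fun r hr => by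
    obtain ⟨x, b, y, rfl⟩ := hrels r hr
    exact (lift_eq_one_iff t x b y).2 (ht x b y hr)
  exact ⟨(PresentedGroup.toGroup h).comp e.symm.toMonoidHom, fun x => by simp [gen]⟩

theorem linearIndependent_rep (hrels : ∀ r ∈ rels, IsWirtingerRelator r) :
    LinearIndependent ℤ
      fun c => Additive.ofMul (Abelianization.of (rep e c)) := by
  let t : X → Multiplicative (Quot (ConjRel rels) →₀ ℤ) := fun x =>
    .ofAdd (single (Quot.mk _ x) 1)
  obtain ⟨φ, hφ⟩ := exists_hom e hrels t fun x b y h => by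
    have : Quot.mk (ConjRel rels) x = Quot.mk _ y := Quot.sound ⟨b, h⟩
    simp [t, this]
  let L : Additive (Abelianization G) →ₗ[ℤ] (Quot (ConjRel rels) →₀ ℤ) :=
    (MonoidHom.toAdditiveLeft (Abelianization.lift φ)).toIntLinearMap
  have hL : ∀ g, L (Additive.ofMul (Abelianization.of g)) = (φ g).toAdd := fun _ => rfl
  have h : L ∘ (fun c => Additive.ofMul (Abelianization.of (rep e c))) =
      Finsupp.basisSingleOne (R := ℤ) (ι := Quot (ConjRel rels)) := by
    funext c
    rw [Function.comp_apply, hL, rep, hφ]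
    simp [t]
  exact LinearIndependent.of_comp L (h ▸ Module.Basis.linearIndependent _)

theorem mul_comm_lift (f : TwoCocycle G (AddCircle (1 : ℚ)))
    (hf : ∀ c g, rep e c * g = g * rep e c →
      f.toFun (rep e c) g = f.toFun g (rep e c))
    (c : Quot (ConjRel rels)) (u v : f.Extension)
    (h : u.fst⁻¹ * rep e c * u.fst = v.fst⁻¹ * rep e c * v.fst) :
    u⁻¹ * ⟨rep e c, 0⟩ * u = v⁻¹ * ⟨rep e c, 0⟩ * v := by
  have h1 : rep e c * (u.fst * v.fst⁻¹) = u.fst * v.fst⁻¹ * rep e c := by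
    calc _ = u.fst * (u.fst⁻¹ * rep e c * u.fst) * v.fst⁻¹ := by group
      _ = u.fst * (v.fst⁻¹ * rep e c * v.fst) * v.fst⁻¹ := by rw [h]
      _ = _ := by group
  have h2 : (⟨rep e c, 0⟩ : f.Extension) * (u * v⁻¹) = u * v⁻¹ * ⟨rep e c, 0⟩ :=
    TwoCocycle.Extension.mul_comm_of_fst h1 (hf c _ h1)
  calc _ = u⁻¹ * ((⟨rep e c, 0⟩ : f.Extension) * (u * v⁻¹)) * v := by group
    _ = u⁻¹ * (u * v⁻¹ * ⟨rep e c, 0⟩) * v := by rw [h2]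
    _ = _ := by group

theorem exists_section (hrels : ∀ r ∈ rels, IsWirtingerRelator r)
    (f : TwoCocycle G (AddCircle (1 : ℚ)))
    (hf : ∀ c g, rep e c * g = g * rep e c →
      f.toFun (rep e c) g = f.toFun g (rep e c)) :
    ∃ s : G →* f.Extension, ∀ g, (s g).fst = g := by
  choose g hg using exists_conj_rep e
  let a : Quot (ConjRel rels) → f.Extension := fun c => ⟨rep e c, 0⟩
  let u : X → f.Extension := fun x => ⟨g x, 0⟩
  let t : X → f.Extension := fun x => (u x)⁻¹ * a (Quot.mk _ x) * u x
  have ht : ∀ x, (t x).fst = gen e x := hg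
  obtain ⟨s, hs⟩ := exists_hom e hrels t fun x b y h => by
    have hxy : Quot.mk (ConjRel rels) x = Quot.mk _ y := Quot.sound ⟨b, h⟩
    calc (t b)⁻¹ * t x * t b = (u x * t b)⁻¹ * a (Quot.mk _ x) * (u x * t b) := by
          simp only [t]; group
      _ = (u x * t b)⁻¹ * a (Quot.mk _ y) * (u x * t b) := by rw [hxy]
      _ = t y := by
        refine mul_comm_lift e f hf _ _ _ ?_
        have hy := hg y
        simp only [TwoCocycle.Extension.mul_fst, ht]
        refine Eq.trans ?_ hy.symm
        rw [← gen_conj e h, ← hg x, hxy]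
        simp only [u]
        group
  have : (TwoCocycle.Extension.proj f).comp s = MonoidHom.id _ :=
    MonoidHom.eq_of_eqOn_dense (closure_range_gen e) fun _ ⟨x, hx⟩ => by
      rw [← hx]
      change (s (gen e x)).fst = _
      rw [hs, ht]
      rfl
  exact ⟨s, fun g => DFunLike.congr_fun this g⟩

theorem mem_barSpan_range_rep (hrels : ∀ r ∈ rels, IsWirtingerRelator r)
    (h : H2 G) : h ∈ barSpan (Set.range (rep e)) := by
  by_contra hh
  obtain ⟨χ, hχ, hne⟩ := CharacterModule.exists_ne_zero_of_notMem _ hh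
  obtain ⟨z, hz, rfl⟩ := H2cls_surjective h
  let χ' : H2 G →+ AddCircle (1 : ℚ) := χ
  obtain ⟨F, hF⟩ := CharacterModule.exists_extension (Z2 G).subtype
    (χ'.comp (B2 G).mkQ.toAddMonoidHom : _ →+ AddCircle (1 : ℚ))
    fun a ha => by
      rw [Submodule.subtype_apply, ZeroMemClass.coe_eq_zero] at ha
      rw [ha]
      exact map_zero _
  have hF' : ∀ w (hw : w ∈ Z2 G), F w = χ (H2cls _ w hw) :=
    fun w hw => hF ⟨w, hw⟩
  have hF3 : ∀ x, F (d3 G x) = 0 := fun x => by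
    have h0 : H2cls _ _ (d2_comp_d3 x) = 0 := (Submodule.Quotient.mk_eq_zero _).2 ⟨x, rfl⟩
    rw [hF' _ (d2_comp_d3 x), h0]
    exact map_zero χ'
  let f : TwoCocycle G (AddCircle (1 : ℚ)) :=
    { toFun g h := F (single (g, h) 1)
      cocycle g h k := by
        have := hF3 (single (g, h, k) 1)
        rwa [d3_single, map_sub, map_add, map_sub] at this }
  obtain ⟨s, hs⟩ := exists_section e hrels f fun c g hc => by
    have h1 := hF' _ (barChain_mem _ _ _ hc)
    rw [← barCls_of_comm hc, hχ _ (barCls_mem_barSpan ⟨c, rfl⟩ hc), barChain, map_sub,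
      sub_eq_zero] at h1
    exact h1
  refine hne ?_
  rw [← hF' z hz]
  exact TwoCocycle.character_eq_zero_of_section F f (fun _ _ => rfl) s hs z hz

theorem exists_homological_basis (e : PresentedGroup rels ≃* G)
    (hrels : ∀ r ∈ rels, IsWirtingerRelator r) :
    ∃ B : Set G, Subgroup.normalClosure B = ⊤ ∧
      LinearIndependent ℤ (fun a : B => Additive.ofMul (Abelianization.of (a : G))) ∧
      ∀ h : H2 G, ∃ (s : Finset B) (gfam : B → G),
        (∀ a ∈ s, gfam a ∈ Subgroup.centralizer {(a : G)}) ∧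
        h = ∑ a ∈ s, barCls _ (a : G) (gfam a) := by
  have hli := linearIndependent_rep e hrels
  have hinj : Function.Injective (rep e) := fun c d h =>
    hli.injective (congrArg (fun g => Additive.ofMul (Abelianization.of g)) h)
  refine ⟨Set.range (rep e), normalClosure_range_rep e, ?_, fun h =>
    exists_sum_barCls_of_mem_barSpan (mem_barSpan_range_rep e hrels h)⟩
  exact (linearIndependent_equiv (Equiv.ofInjective _ hinj)).1 hli

end

end IsWirtingerGroup

/-! ### The homological conditions imply the existence of a Wirtinger presentation -/

theorem span_range_abelianization_eq_top {G : Type*} [Group G] {B : Set G}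
    (hB : Subgroup.normalClosure B = ⊤) :
    Submodule.span ℤ (Set.range fun a : B => Additive.ofMul (Abelianization.of (a : G))) = ⊤ := by
  rw [eq_top_iff]
  rintro x -
  obtain ⟨g, rfl⟩ : ∃ g : G, Additive.ofMul (Abelianization.of g) = x :=
    QuotientGroup.mk_surjective x.toMul
  have hg : g ∈ Subgroup.closure (Group.conjugatesOfSet B) := by
    change g ∈ Subgroup.normalClosure B
    rw [hB]
    trivial
  induction hg using Subgroup.closure_induction with
  | mem x hx =>
    obtain ⟨a, ha, hc⟩ := Group.mem_conjugatesOfSet_iff.1 hx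
    obtain ⟨c, rfl⟩ := isConj_iff.1 hc
    refine Submodule.subset_span ⟨⟨a, ha⟩, ?_⟩
    simp [mul_comm]
  | one => simp
  | mul x y _ _ hx hy => simpa using add_mem hx hy
  | inv x _ hx => simpa using hx

open scoped IsMulCommutative in
theorem injective_of_ker_le_center {E G : Type*} [Group E] [Group G] {B : Set G}
    (p : E →* G) (hp : Function.Surjective p) (hk : p.ker ≤ Subgroup.center E)
    (hcomm : ∀ a ∈ B, ∃ x, p x = a ∧ ∀ w, Commute a (p w) → Commute x w)
    (hB : ∀ h : H2 G, ∃ (s : Finset B) (gfam : B → G),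
      (∀ a ∈ s, gfam a ∈ Subgroup.centralizer {(a : G)}) ∧
      h = ∑ a ∈ s, barCls G (a : G) (gfam a))
    (hab : ∀ φ : E →* Multiplicative (AddCircle (1 : ℚ)), p.ker ≤ φ.ker) :
    Function.Injective p := by
  rw [← MonoidHom.ker_eq_bot_iff, eq_bot_iff]
  intro k hkp
  by_contra hk1
  rw [Subgroup.mem_bot] at hk1
  have hne : (Additive.ofMul (⟨k, hk hkp⟩ : Subgroup.center E)) ≠ 0 := fun h =>
    hk1 (congrArg (fun z : Additive (Subgroup.center E) => (z.toMul : E)) h)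
  obtain ⟨χ₀, hχ₀⟩ := CharacterModule.exists_character_apply_ne_zero_of_ne_zero
    (A := Additive (Subgroup.center E)) hne
  let χ : Additive (Subgroup.center E) →+ AddCircle (1 : ℚ) := χ₀
  let s := Function.surjInv hp
  have hs : ∀ g, p (s g) = g := Function.surjInv_eq hp
  have hz : ∀ w, w * (s (p w))⁻¹ ∈ Subgroup.center E := fun w => hk (by
    rw [MonoidHom.mem_ker, map_mul, map_inv, hs, mul_inv_cancel])
  let z : E → Additive (Subgroup.center E) := fun w => .ofMul ⟨w * (s (p w))⁻¹, hz w⟩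
  have hzmul : ∀ u v, z (u * v) = z u + z v + z (s (p u) * s (p v)) := fun u v => by
    refine Subtype.ext (a1 := (z (u * v)).toMul) ?_
    change u * v * (s (p (u * v)))⁻¹ = u * (s (p u))⁻¹ * (v * (s (p v))⁻¹) *
      (s (p u) * s (p v) * (s (p (s (p u) * s (p v))))⁻¹)
    have hv := Subgroup.mem_center_iff.1 (hz v) (s (p u))
    rw [map_mul, map_mul, hs, hs]
    calc _ = u * (s (p u))⁻¹ * (s (p u) * (v * (s (p v))⁻¹)) * s (p v) * (s (p u * p v))⁻¹ := by
          group
      _ = _ := by rw [hv]; group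
  let F : ((G × G) →₀ ℤ) →ₗ[ℤ] AddCircle (1 : ℚ) :=
    Finsupp.lift _ ℤ _ fun q => χ (z (s q.1 * s q.2))
  have hF : ∀ g h, F (single (g, h) 1) = χ (z (s g * s h)) := fun g h => by simp [F]
  have hF3 : ∀ x, F (d3 G x) = 0 := fun x => by
    have : F.comp (d3 G) = 0 := by
      ext ⟨g, h, k⟩
      have h1 := congrArg χ (hzmul (s g * s h) (s k))
      have h2 := congrArg χ (hzmul (s g) (s h * s k))
      have h0 : ∀ g, χ (z (s g)) = 0 := fun g => by
        have : z (s g) = 0 := Subtype.ext (a1 := (z (s g)).toMul) (by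
          change s g * (s (p (s g)))⁻¹ = 1
          rw [hs, mul_inv_cancel])
        rw [this, map_zero]
      simp only [map_mul, hs, map_add, h0, add_zero, zero_add, mul_assoc] at h1 h2
      rw [h1] at h2
      simp only [LinearMap.comp_apply, Finsupp.lsingle_apply, d3_single, map_sub, map_add, hF,
        LinearMap.zero_apply]
      rw [← sub_eq_zero] at h2
      rw [← neg_eq_zero, ← h2]
      abel
    exact DFunLike.congr_fun this x
  have hFB : ∀ a ∈ B, ∀ g, a * g = g * a → F (barChain G a g) = 0 := fun a ha g hag => by
    obtain ⟨x, hx, hxw⟩ := hcomm a ha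
    have hxg : Commute x (s g) := hxw _ (by rw [hs]; exact hag)
    have hc : Commute (x * (s (p x))⁻¹) (s g) :=
      (Subgroup.mem_center_iff.1 (hz x) (s g)).symm
    have hsa : s a = (x * (s (p x))⁻¹)⁻¹ * x := by rw [hx]; group
    have : s a * s g = s g * s a := by
      rw [hsa]
      exact hc.inv_left.mul_left hxg
    rw [barChain, map_sub, hF, hF, this, sub_self]
  obtain ⟨c₀, hc₀⟩ := CharacterModule.exists_extension (d2 G) (F.toAddMonoidHom : _ →+ _)
    (character_eq_zero_of_barSpan (F.toAddMonoidHom : _ →+ _) hF3 hFB hB)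
  let c : (G →₀ ℤ) →+ AddCircle (1 : ℚ) := c₀
  have hc : ∀ g h, c (single h 1) - c (single (g * h) 1) + c (single g 1) =
      χ (z (s g * s h)) := fun g h => by
    rw [← hF, ← map_sub, ← map_add, ← d2_single]
    exact hc₀ _
  let φ : E →* Multiplicative (AddCircle (1 : ℚ)) :=
    MonoidHom.mk' (fun w => .ofAdd (χ (z w) + c (single (p w) 1))) fun u v => by
      refine (congrArg Multiplicative.ofAdd ?_).trans (ofAdd_add _ _)
      rw [hzmul, map_mul, map_add χ, map_add χ, ← hc]
      abel
  have h1 : φ k = φ 1 := by rw [map_one]; exact hab φ hkp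
  have h2 : χ (z k) = χ (z 1) := by
    have h3 : χ (z k) + c (single (p k) 1) = χ (z 1) + c (single (p 1) 1) := h1
    rwa [MonoidHom.mem_ker.1 hkp, map_one, add_left_inj] at h3
  have h3 : z k = .ofMul ⟨k, hk hkp⟩ + z 1 := by
    refine Subtype.ext (a1 := (z k).toMul) ?_
    change k * (s (p k))⁻¹ = k * (1 * (s (p 1))⁻¹)
    rw [MonoidHom.mem_ker.1 hkp, map_one, one_mul]
  rw [h3, map_add, add_eq_right] at h2
  exact hχ₀ h2

section Presentation

variable {G : Type*} [Group G] (B : Set G)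

/-- All Wirtinger relators in the conjugates of `B` that hold in `G`. -/
def conjRels : Set (FreeGroup (Group.conjugatesOfSet B)) :=
  {r | IsWirtingerRelator r ∧ FreeGroup.lift Subtype.val r = 1}

/-- The canonical homomorphism to `G` from the group generated by the conjugates of `B`, subject
to the Wirtinger relations holding in `G`. -/
def conjRelsHom : PresentedGroup (conjRels B) →* G :=
  PresentedGroup.toGroup (f := Subtype.val) fun _ hr => hr.2

variable {B}

@[simp]
theorem conjRelsHom_of (x : Group.conjugatesOfSet B) :
    conjRelsHom B (PresentedGroup.of x) = x :=
  PresentedGroup.toGroup.of _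

/-- Conjugation of elements of `Group.conjugatesOfSet B` by `g`. -/
def conjBy (g : G) (x : Group.conjugatesOfSet B) : Group.conjugatesOfSet B :=
  ⟨g⁻¹ * x * g, by simpa using Group.conj_mem_conjugatesOfSet (c := g⁻¹) x.2⟩

theorem inv_mul_gen_mul (w : PresentedGroup (conjRels B)) (x : Group.conjugatesOfSet B) :
    w⁻¹ * PresentedGroup.of x * w = PresentedGroup.of (conjBy (conjRelsHom B w) x) := by
  have hw : w ∈ Subgroup.closure (Set.range (PresentedGroup.of (rels := conjRels B))) := by
    rw [PresentedGroup.closure_range_of]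
    trivial
  induction hw using Subgroup.closure_induction generalizing x with
  | mem w hw =>
    obtain ⟨b, rfl⟩ := hw
    have hr : (FreeGroup.of b)⁻¹ * FreeGroup.of x * FreeGroup.of b *
        (FreeGroup.of (conjBy (b : G) x))⁻¹ ∈ conjRels B :=
      ⟨⟨x, b, _, rfl⟩, by simp [conjBy]⟩
    have := PresentedGroup.one_of_mem hr
    rw [map_mul, map_mul, map_mul, map_inv, map_inv, mul_inv_eq_one] at this
    rw [conjRelsHom_of]
    exact this
  | one => simp [conjBy]
  | mul u v _ _ hu hv =>
    calc (u * v)⁻¹ * PresentedGroup.of x * (u * v)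
        = v⁻¹ * (u⁻¹ * PresentedGroup.of x * u) * v := by group
      _ = PresentedGroup.of (conjBy (conjRelsHom B (u * v)) x) := by
        rw [hu, hv]
        congr 1
        simp [conjBy, mul_assoc]
  | inv u _ hu =>
    have h := hu (conjBy (conjRelsHom B u⁻¹) x)
    have hx : conjBy (conjRelsHom B u) (conjBy (conjRelsHom B u⁻¹) x) = x := by
      simp [conjBy, mul_assoc]
    rw [hx] at h
    rw [← h]
    group

theorem commute_of (w : PresentedGroup (conjRels B)) (x : Group.conjugatesOfSet B)
    (h : Commute (x : G) (conjRelsHom B w)) : Commute (PresentedGroup.of x) w := by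
  have hx : conjBy (conjRelsHom B w) x = x := Subtype.ext (by
    change (conjRelsHom B w)⁻¹ * x * conjRelsHom B w = x
    rw [mul_assoc, h.eq, inv_mul_cancel_left])
  have := inv_mul_gen_mul w x
  rw [hx, mul_assoc, inv_mul_eq_iff_eq_mul] at this
  exact this

theorem ker_conjRelsHom_le_center : (conjRelsHom B).ker ≤ Subgroup.center _ := fun k hk => by
  rw [Subgroup.mem_center_iff]
  intro w
  have hw : w ∈ Subgroup.closure (Set.range (PresentedGroup.of (rels := conjRels B))) := by
    rw [PresentedGroup.closure_range_of]
    trivial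
  change Commute w k
  induction hw using Subgroup.closure_induction with
  | mem w hw =>
    obtain ⟨x, rfl⟩ := hw
    exact commute_of k x (by rw [MonoidHom.mem_ker.1 hk]; exact Commute.one_right _)
  | one => exact Commute.one_left _
  | mul u v _ _ hu hv => exact hu.mul_left hv
  | inv u _ hu => exact hu.inv_left

theorem conjRelsHom_surjective (hB : Subgroup.normalClosure B = ⊤) :
    Function.Surjective (conjRelsHom B) := by
  rw [← MonoidHom.range_eq_top, eq_top_iff, ← hB]
  exact (Subgroup.closure_le _).2 fun x hx => ⟨PresentedGroup.of ⟨x, hx⟩, conjRelsHom_of _⟩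

theorem ker_conjRelsHom_le_ker (hB : Subgroup.normalClosure B = ⊤)
    (hli : LinearIndependent ℤ fun a : B => Additive.ofMul (Abelianization.of (a : G)))
    {A : Type*} [CommGroup A] (φ : PresentedGroup (conjRels B) →* A) :
    (conjRelsHom B).ker ≤ φ.ker := by
  let gen : B → PresentedGroup (conjRels B) := fun a =>
    PresentedGroup.of ⟨a, Group.subset_conjugatesOfSet a.2⟩
  have hpgen : ∀ a, conjRelsHom B (gen a) = a := fun a => conjRelsHom_of _
  let lcφ := Finsupp.linearCombination ℤ fun a : B => Additive.ofMul (φ (gen a))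
  let lc := Finsupp.linearCombination ℤ fun a : B => Additive.ofMul (Abelianization.of (a : G))
  have key : ∀ w : PresentedGroup (conjRels B), ∃ v, lcφ v = Additive.ofMul (φ w) ∧
      lc v = Additive.ofMul (Abelianization.of (conjRelsHom B w)) := by
    intro w
    have hw : w ∈ Subgroup.closure (Set.range (PresentedGroup.of (rels := conjRels B))) := by
      rw [PresentedGroup.closure_range_of]
      trivial
    induction hw using Subgroup.closure_induction with
    | mem w hw =>
      obtain ⟨x, rfl⟩ := hw
      obtain ⟨a, ha, hc⟩ := Group.mem_conjugatesOfSet_iff.1 x.2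
      obtain ⟨g, hg⟩ := isConj_iff.1 hc
      obtain ⟨w, hw⟩ : ∃ w, w⁻¹ * gen ⟨a, ha⟩ * w = PresentedGroup.of x := by
        obtain ⟨w, hw⟩ := conjRelsHom_surjective hB g⁻¹
        refine ⟨w, ?_⟩
        rw [inv_mul_gen_mul, hw]
        congr 1
        exact Subtype.ext (by simpa [conjBy] using hg)
      refine ⟨single ⟨a, ha⟩ 1, ?_, ?_⟩
      · simp only [lcφ, Finsupp.linearCombination_single, one_smul, ← hw]
        simp [mul_comm]
      · simp only [lc, Finsupp.linearCombination_single, one_smul, ← hw]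
        simp [mul_comm, hpgen]
    | one => exact ⟨0, by simp, by simp⟩
    | mul u v _ _ hu hv =>
      obtain ⟨x, hx, hx'⟩ := hu
      obtain ⟨y, hy, hy'⟩ := hv
      exact ⟨x + y, by simp [hx, hy], by simp [hx', hy']⟩
    | inv u _ hu =>
      obtain ⟨x, hx, hx'⟩ := hu
      exact ⟨-x, by simp [hx], by simp [hx']⟩
  intro k hk
  obtain ⟨v, hv, hv'⟩ := key k
  rw [MonoidHom.mem_ker.1 hk, map_one] at hv'
  rw [linearIndependent_iff.1 hli v hv', map_zero] at hv
  exact MonoidHom.mem_ker.2 hv.symm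

end Presentation

theorem nonempty_abelianization_addEquiv {G : Type u} [Group G] {B : Set G}
    (hB : Subgroup.normalClosure B = ⊤)
    (hli : LinearIndependent ℤ fun a : B => Additive.ofMul (Abelianization.of (a : G))) :
    Nonempty (Additive (Abelianization G) ≃+ FreeAbelianGroup B) :=
  ⟨(Module.Basis.mk hli (span_range_abelianization_eq_top hB).ge).repr.toAddEquiv.trans
    (FreeAbelianGroup.equivFinsupp B).symm⟩

/-- Kuz'min's characterization: a group `G` is a Wirtinger group if and only if its
abelianization is free abelian and there is a subset `B ⊆ G` such that (1) `G` is the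
normal closure of `B`, (2) the classes of elements of `B` in the abelianization are
linearly independent, and (3) the homomorphism
`ζ : ⊕_{a ∈ B} C_G(a) → H₂G, (g_a) ↦ Σ_a [a|g_a] - [g_a|a]` is surjective. -/
theorem isWirtingerGroup_iff (G : Type u) [Group G] :
    IsWirtingerGroup G ↔
      (∃ ι : Type u, Nonempty (Additive (Abelianization G) ≃+ FreeAbelianGroup ι)) ∧
      ∃ B : Set G,
        Subgroup.normalClosure B = ⊤ ∧
        LinearIndependent ℤ
          (fun a : B => Additive.ofMul (Abelianization.of (a : G))) ∧
        ∀ h : H2 G, ∃ (s : Finset B) (gfam : B → G),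
          (∀ a ∈ s, gfam a ∈ Subgroup.centralizer {(a : G)}) ∧
          h = ∑ a ∈ s, barCls G (a : G) (gfam a) := by
  constructor
  · rintro ⟨X, rels, hrels, ⟨e⟩⟩
    obtain ⟨B, hB, hli, hH⟩ := IsWirtingerGroup.exists_homological_basis e.symm hrels
    exact ⟨⟨B, nonempty_abelianization_addEquiv hB hli⟩, B, hB, hli, hH⟩
  · rintro ⟨-, B, hB, hli, hH⟩
    refine ⟨Group.conjugatesOfSet B, conjRels B, fun r hr => hr.1,
      ⟨(MulEquiv.ofBijective (conjRelsHom B) ⟨?_, conjRelsHom_surjective hB⟩).symm⟩⟩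
    refine injective_of_ker_le_center _ (conjRelsHom_surjective hB)
      ker_conjRelsHom_le_center (fun a ha => ?_) hH fun φ => ker_conjRelsHom_le_ker hB hli φ
    exact ⟨PresentedGroup.of ⟨a, Group.subset_conjugatesOfSet ha⟩, conjRelsHom_of _,
      fun w hw => commute_of w _ hw⟩

end
end

section
/- Let G be a group, let B ⊆ G be a subset such that (1) G is the normal closure of B, (2) the classes of elements of B in the abelianization G_ab are linearly independent, and (3) the map ζ : ⊕_{a∈B} C_G(a) → H₂G, (g_a)_{a∈B} ↦ Σ_{a∈B} cls([a|g_a] − [g_a|a]) is surjective. For each a ∈ B let ε_a : G → ℤ be the homomorphism determined by ε_a(b) = 1 if b = a and ε_a(b) = 0 for b ∈ B with b ≠ a. Then the restriction of ζ to ⊕_{a∈B} (C_G(a) ∩ Ker ε_a) is still surjective onto H₂G; i.e., every class in H₂G equals a finite sum Σ_{a∈B} cls([a|g_a] − [g_a|a]) with each g_a ∈ C_G(a) ∩ Ker ε_a. -/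
open Finsupp

noncomputable section

universe u

/-- The class `barCls G a g` is additive in `g` on the centralizer of `a`. -/
theorem barCls_mul_right (G : Type*) [Group G] {a g h : G} (hg : a * g = g * a)
    (hh : a * h = h * a) : barCls G a (g * h) = barCls G a g + barCls G a h := by
  have hgh : a * (g * h) = g * h * a := by rw [← mul_assoc, hg, mul_assoc, hh, mul_assoc]
  rw [barCls, barCls, barCls, dif_pos hg, dif_pos hh, dif_pos hgh]
  simp only [H2cls]
  rw [← Submodule.Quotient.mk_add, Submodule.Quotient.eq]
  refine ⟨single (a, g, h) 1 - single (g, a, h) 1 + single (g, h, a) 1, ?_⟩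
  simp only [d3, barChain, map_add, map_sub, Finsupp.lift_apply, Submodule.subtype_apply]
  rw [sum_single_index (by simp), sum_single_index (by simp), sum_single_index (by simp)]
  simp only [one_smul, hg, hh]
  abel

theorem barCls_self (G : Type*) [Group G] (a : G) : barCls G a a = 0 := by
  rw [barCls, dif_pos rfl, H2cls, Submodule.Quotient.mk_eq_zero]
  exact ⟨0, by simp [barChain]⟩

/-- The homomorphism `g ↦ barCls G a g` on the centralizer of `a`. -/
def barClsHom (G : Type*) [Group G] (a : G) :
    Subgroup.centralizer {a} →* Multiplicative (H2 G) :=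
  MonoidHom.mk' (fun g => Multiplicative.ofAdd (barCls G a g)) fun g h => by
    rw [← ofAdd_add, Subgroup.coe_mul, barCls_mul_right G
      (Subgroup.mem_centralizer_singleton_iff.1 g.2).symm
      (Subgroup.mem_centralizer_singleton_iff.1 h.2).symm]

theorem barCls_mul_zpow_self (G : Type*) [Group G] {a g : G}
    (hg : g ∈ Subgroup.centralizer {a}) (n : ℤ) : barCls G a (g * a ^ n) = barCls G a g := by
  have ha : a ∈ Subgroup.centralizer {a} := Subgroup.mem_centralizer_singleton_iff.2 rfl
  have h0 : barClsHom G a ⟨a, ha⟩ = 1 := barCls_self G a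
  have h := map_mul (barClsHom G a) ⟨g, hg⟩ (⟨a, ha⟩ ^ n)
  rw [map_zpow, h0, one_zpow, mul_one] at h
  exact h

/-- Theorem (main): if `B ⊆ G` satisfies (1) `G` is the normal closure of `B`,
(2) the classes of elements of `B` in the abelianization are linearly independent, and
(3) `ζ : ⊕_{a ∈ B} C_G(a) → H₂G, (g_a) ↦ Σ_a [a|g_a] - [g_a|a]` is surjective, and if
`ε_a : G → ℤ` are homomorphisms with `ε_a(a) = 1` and `ε_a(b) = 0` for `b ∈ B`,
`b ≠ a`, then `ζ` restricted to `⊕_{a ∈ B} (C_G(a) ∩ Ker ε_a)` is still surjective. -/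
theorem zeta_restricted_surjective (G : Type u) [Group G] (B : Set G)
    (h1 : Subgroup.normalClosure B = ⊤)
    (h2 : LinearIndependent ℤ
      (fun a : B => Additive.ofMul (Abelianization.of (a : G))))
    (h3 : ∀ h : H2 G, ∃ (s : Finset B) (gfam : B → G),
      (∀ a ∈ s, gfam a ∈ Subgroup.centralizer {(a : G)}) ∧
      h = ∑ a ∈ s, barCls G (a : G) (gfam a))
    (ε : B → G →* Multiplicative ℤ)
    (hε1 : ∀ a : B, ε a (a : G) = Multiplicative.ofAdd 1)
    (hε0 : ∀ a b : B, b ≠ a → ε a (b : G) = 1) :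
    ∀ h : H2 G, ∃ (s : Finset B) (gfam : B → G),
      (∀ a ∈ s, gfam a ∈ Subgroup.centralizer {(a : G)} ∧ gfam a ∈ (ε a).ker) ∧
      h = ∑ a ∈ s, barCls G (a : G) (gfam a) := by
  intro h
  obtain ⟨s, gfam, hs, rfl⟩ := h3 h
  refine ⟨s, fun a => gfam a * (a : G) ^ (-(ε a (gfam a)).toAdd), fun a ha => ⟨?_, ?_⟩,
    Finset.sum_congr rfl fun a ha => (barCls_mul_zpow_self G (hs a ha) _).symm⟩
  · exact mul_mem (hs a ha)
      (zpow_mem (Subgroup.mem_centralizer_singleton_iff.2 rfl) _)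
  · rw [MonoidHom.mem_ker, map_mul, map_zpow, hε1, ← ofAdd_zsmul]
    simp

end
end

section
/- Let G be the group presented with generators g, x, y, z and relations g⁻¹xg = y, g⁻¹yg = z, g⁻¹zg = x, y⁻¹gy = x, y⁻¹xy = z, y⁻¹zy = g. Then the commutator subgroup [G,G] of G is a finite group of order 8 isomorphic to the quaternion group Q₈, and G is isomorphic to a semidirect product of Q₈ with an infinite cyclic group generated by (the image of) g. -/
open FreeGroup in
/-- The relators of Kuz'min's Example 2, on generators `g, x, y, z` (encoded as
`0, 1, 2, 3 : Fin 4`): `g⁻¹xg = y`, `g⁻¹yg = z`, `g⁻¹zg = x`, `y⁻¹gy = x`,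
`y⁻¹xy = z`, `y⁻¹zy = g`. -/
def kuzminRels : Set (FreeGroup (Fin 4)) :=
  { (of 0)⁻¹ * of 1 * of 0 * (of 2)⁻¹,
    (of 0)⁻¹ * of 2 * of 0 * (of 3)⁻¹,
    (of 0)⁻¹ * of 3 * of 0 * (of 1)⁻¹,
    (of 2)⁻¹ * of 0 * of 2 * (of 1)⁻¹,
    (of 2)⁻¹ * of 1 * of 2 * (of 3)⁻¹,
    (of 2)⁻¹ * of 3 * of 2 * (of 0)⁻¹ }

/-- Kuz'min's group: the group presented by generators `g, x, y, z` and relations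
`g⁻¹xg = y`, `g⁻¹yg = z`, `g⁻¹zg = x`, `y⁻¹gy = x`, `y⁻¹xy = z`, `y⁻¹zy = g`. -/
def KuzminGroup : Type :=
  PresentedGroup kuzminRels

instance : Group KuzminGroup :=
  inferInstanceAs (Group (PresentedGroup kuzminRels))

/-- The image of the generator `g` in Kuz'min's group. -/
def kuzminG : KuzminGroup :=
  PresentedGroup.of (rels := kuzminRels) 0

namespace QuaternionGroup

variable {n : ℕ} {H : Type*} [Group H]

/-- The homomorphism `k ↦ u ^ k` out of `ZMod m`, for `u` with `u ^ m = 1`. -/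
def zmodPowers {m : ℕ} (u : H) (hu : u ^ m = 1) : ZMod m →+ Additive H :=
  ZMod.lift m ⟨zmultiplesHom (Additive H) (Additive.ofMul u), by
    rw [zmultiplesHom_apply, natCast_zsmul, ← ofMul_pow, hu, ofMul_one]⟩

theorem toMul_zmodPowers_intCast {m : ℕ} (u : H) (hu : u ^ m = 1) (k : ℤ) :
    (zmodPowers u hu k).toMul = u ^ k := by
  simp [zmodPowers]

/-- The homomorphism out of a quaternion group determined by images `u` of `a 1` and `v` of `xa 0`
satisfying the defining relations. -/
def lift (u v : H) (hu : u ^ (2 * n) = 1) (hv : v * v = u ^ n) (huv : u * v = v * u⁻¹) :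
    QuaternionGroup n →* H :=
  let A : ZMod (2 * n) →+ Additive H := zmodPowers u hu
  have hA (k : ℤ) : (A k).toMul = u ^ k := toMul_zmodPowers_intCast u hu k
  have hAv (i : ZMod (2 * n)) : (A i).toMul * v = v * (A (-i)).toMul := by
    obtain ⟨k, rfl⟩ := ZMod.intCast_surjective i
    rw [← Int.cast_neg, hA, hA, zpow_neg, ← inv_zpow]
    have h : SemiconjBy v u⁻¹ u := huv.symm
    exact (h.zpow_right k).eq.symm
  have hAn : (A (n : ZMod (2 * n))).toMul = v * v := by
    have := hA n
    rw [Int.cast_natCast] at this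
    rw [this, hv, zpow_natCast]
  { toFun
      | a i => (A i).toMul
      | xa i => v * (A i).toMul
    map_one' := by
      change (A 0).toMul = 1
      simp
    map_mul' := by
      rintro (i | i) (j | j)
      · simp
      · simp only [a_mul_xa, sub_eq_neg_add, map_add, toMul_add, ← mul_assoc, hAv]
      · simp [mul_assoc]
      · simp only [xa_mul_xa]
        rw [add_sub_assoc, sub_eq_neg_add, A.map_add, A.map_add, toMul_add, toMul_add, hAn,
          mul_assoc v (A i).toMul, ← mul_assoc (A i).toMul v, hAv]
        simp only [mul_assoc] }

@[simp]
theorem lift_a_one (u v : H) (hu : u ^ (2 * n) = 1) (hv : v * v = u ^ n)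
    (huv : u * v = v * u⁻¹) : lift u v hu hv huv (a 1) = u := by
  simpa [lift] using toMul_zmodPowers_intCast u hu 1

@[simp]
theorem lift_xa_zero (u v : H) (hu : u ^ (2 * n) = 1) (hv : v * v = u ^ n)
    (huv : u * v = v * u⁻¹) : lift u v hu hv huv (xa 0) = v := by
  simp [lift]

theorem hom_ext [NeZero n] {f f' : QuaternionGroup n →* H} (ha : f (a 1) = f' (a 1))
    (hxa : f (xa 0) = f' (xa 0)) : f = f' := by
  have h (i : ZMod (2 * n)) : f (a i) = f' (a i) := by
    rw [← ZMod.natCast_zmod_val i, ← a_one_pow, map_pow, map_pow, ha]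
  ext (i | i)
  · exact h i
  · rw [← zero_add i, ← xa_mul_a, map_mul, map_mul, h, hxa]

/-- The automorphism of order three of `Q₈` permuting cyclically `i = a 1`, `k = xa 3` and
`j = xa 0`. -/
def rotate : MulAut (QuaternionGroup 2) where
  toFun
    | a i => (![a 0, xa 3, a 2, xa 1] : Fin 4 → QuaternionGroup 2) i
    | xa i => (![a 1, xa 2, a 3, xa 0] : Fin 4 → QuaternionGroup 2) i
  invFun
    | a i => (![a 0, xa 0, a 2, xa 2] : Fin 4 → QuaternionGroup 2) i
    | xa i => (![xa 3, a 3, xa 1, a 1] : Fin 4 → QuaternionGroup 2) i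
  left_inv := by unfold Function.LeftInverse; decide
  right_inv := by unfold Function.RightInverse Function.LeftInverse; decide
  map_mul' := by decide

theorem exists_eq_rotate_mul_inv (q : QuaternionGroup 2) :
    ∃ r s, q = (rotate r * r⁻¹) * (rotate s * s⁻¹) := by
  revert q
  decide

end QuaternionGroup

theorem SemidirectProduct.conj_zpowersHom {N H : Type*} [Group N] [Group H] {α : MulAut N}
    {f : N →* H} {t : H} (h : ∀ q, f (α q) = t * f q * t⁻¹) (m : Multiplicative ℤ) :
    f.comp (zpowersHom (MulAut N) α m).toMonoidHom =
      (MulAut.conj (zpowersHom H t m)).toMonoidHom.comp f := by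
  have key (k : ℤ) : ∀ q, f ((α ^ k) q) = t ^ k * f q * (t ^ k)⁻¹ := by
    induction k using Int.induction_on with
    | zero => simp
    | succ k ih =>
      intro q
      rw [zpow_add_one, zpow_add_one, MulAut.mul_apply, ih, h]
      group
    | pred k ih =>
      intro q
      have h' : f (α⁻¹ q) = t⁻¹ * f q * t := by
        have := h (α⁻¹ q)
        rw [MulAut.apply_inv_self] at this
        rw [this]
        group
      rw [zpow_sub_one, zpow_sub_one, MulAut.mul_apply, ih, h']
      group
  ext q
  simpa [zpowersHom_apply, ← map_zpow] using key m.toAdd q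

open QuaternionGroup

/-- `Q₈ ⋊ ℤ`, with the generator of `ℤ` acting by an automorphism of order three. -/
abbrev QuaternionSemidirect : Type :=
  QuaternionGroup 2 ⋊[zpowersHom (MulAut (QuaternionGroup 2)) rotate] Multiplicative ℤ

namespace QuaternionSemidirect

theorem commutator_eq : commutator QuaternionSemidirect =
    (SemidirectProduct.inl : QuaternionGroup 2 →* QuaternionSemidirect).range := by
  apply le_antisymm
  · rw [SemidirectProduct.range_inl_eq_ker_rightHom]
    exact Abelianization.commutator_subset_ker _
  · rintro _ ⟨q, rfl⟩
    have h (r : QuaternionGroup 2) :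
        (SemidirectProduct.inl (rotate r * r⁻¹) : QuaternionSemidirect) ∈
          commutator QuaternionSemidirect := by
      have hr := SemidirectProduct.inl_aut
        (φ := zpowersHom (MulAut (QuaternionGroup 2)) rotate) (Multiplicative.ofAdd 1) r
      rw [show zpowersHom (MulAut (QuaternionGroup 2)) rotate (Multiplicative.ofAdd 1) = rotate by
        simp] at hr
      rw [map_mul, hr, map_inv, map_inv]
      exact Subgroup.commutator_mem_commutator (Subgroup.mem_top _) (Subgroup.mem_top _)
    obtain ⟨r, s, rfl⟩ := exists_eq_rotate_mul_inv q
    rw [map_mul]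
    exact mul_mem (h r) (h s)

/-- The commutator subgroup of `Q₈ ⋊ ℤ` is `Q₈`. -/
noncomputable def commutatorEquiv : commutator QuaternionSemidirect ≃* QuaternionGroup 2 :=
  (MulEquiv.subgroupCongr commutator_eq).trans
    (MonoidHom.ofInjective SemidirectProduct.inl_injective).symm

end QuaternionSemidirect

namespace KuzminGroup

/-- The image of a generator in Kuz'min's group. -/
def of (i : Fin 4) : KuzminGroup :=
  PresentedGroup.of (rels := kuzminRels) i

theorem relations :
    (of 0)⁻¹ * of 1 * of 0 = of 2 ∧ (of 0)⁻¹ * of 2 * of 0 = of 3 ∧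
    (of 0)⁻¹ * of 3 * of 0 = of 1 ∧ (of 2)⁻¹ * of 0 * of 2 = of 1 ∧
    (of 2)⁻¹ * of 1 * of 2 = of 3 ∧ (of 2)⁻¹ * of 3 * of 2 = of 0 := by
  have h (r) (hr : r ∈ kuzminRels) : PresentedGroup.mk kuzminRels r = 1 :=
    PresentedGroup.one_of_mem hr
  simp only [kuzminRels, Set.mem_insert_iff, Set.mem_singleton_iff, forall_eq_or_imp, forall_eq]
    at h
  obtain ⟨h₁, h₂, h₃, h₄, h₅, h₆⟩ := h
  exact ⟨mul_inv_eq_one.1 h₁, mul_inv_eq_one.1 h₂, mul_inv_eq_one.1 h₃, mul_inv_eq_one.1 h₄,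
    mul_inv_eq_one.1 h₅, mul_inv_eq_one.1 h₆⟩

/-- The three elements `x * g⁻¹`, `y * g⁻¹`, `z * g⁻¹` (for `i = 1, 2, 3`). -/
def unit (i : Fin 4) : KuzminGroup := of i * (of 0)⁻¹

theorem conj_unit_one : of 0 * unit 1 * (of 0)⁻¹ = unit 3 := by
  obtain ⟨-, -, h, -⟩ := relations
  simp only [unit, ← h]
  group

theorem conj_unit_two : of 0 * unit 2 * (of 0)⁻¹ = unit 1 := by
  obtain ⟨h, -⟩ := relations
  simp only [unit, ← h]
  group

theorem conj_unit_three : of 0 * unit 3 * (of 0)⁻¹ = unit 2 := by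
  obtain ⟨-, h, -⟩ := relations
  simp only [unit, ← h]
  group

theorem unit_two_mul_unit_three : unit 2 * unit 3 = unit 1 := by
  obtain ⟨h₁, -, h₃, h₄, -⟩ := relations
  have h₃' : (of 0)⁻¹ * of 3 = of 1 * (of 0)⁻¹ := by rw [← h₃]; group
  have h₁' : of 0 * of 2 = of 1 * of 0 := by rw [← h₁]; group
  have h₄' : of 2 * of 1 = of 0 * of 2 := by rw [← h₄]; group
  calc unit 2 * unit 3 = of 2 * ((of 0)⁻¹ * of 3) * (of 0)⁻¹ := by simp only [unit, mul_assoc]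
    _ = of 2 * of 1 * (of 0)⁻¹ * (of 0)⁻¹ := by rw [h₃', mul_assoc (of 2)]; simp only [mul_assoc]
    _ = unit 1 := by rw [h₄', h₁', mul_inv_cancel_right]; rfl

theorem unit_three_mul_unit_one : unit 3 * unit 1 = unit 2 := by
  have h := congrArg (MulAut.conj (of 0)) (congrArg (MulAut.conj (of 0)) unit_two_mul_unit_three)
  simpa only [map_mul, MulAut.conj_apply, conj_unit_one, conj_unit_two, conj_unit_three] using h

theorem unit_one_mul_unit_two : unit 1 * unit 2 = unit 3 := by
  have h := congrArg (MulAut.conj (of 0)) unit_two_mul_unit_three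
  simpa only [map_mul, MulAut.conj_apply, conj_unit_one, conj_unit_two, conj_unit_three] using h

theorem unit_two_mul_self : unit 2 * unit 2 = unit 1 ^ 2 := by
  calc unit 2 * unit 2 = unit 2 * (unit 3 * unit 1) := by rw [unit_three_mul_unit_one]
    _ = unit 1 ^ 2 := by rw [← mul_assoc, unit_two_mul_unit_three, sq]

theorem unit_one_mul_unit_two_eq_mul_inv : unit 1 * unit 2 = unit 2 * (unit 1)⁻¹ := by
  rw [eq_mul_inv_iff_mul_eq, unit_one_mul_unit_two, unit_three_mul_unit_one]

theorem unit_one_pow : unit 1 ^ (2 * 2) = 1 := by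
  have h : SemiconjBy (unit 2) (unit 1)⁻¹ (unit 1) := unit_one_mul_unit_two_eq_mul_inv.symm
  have h2 : (unit 2 * unit 2)⁻¹ = unit 2 * unit 2 := by
    apply mul_left_cancel (a := unit 2)
    simpa only [inv_pow, ← unit_two_mul_self, mul_assoc] using (h.pow_right 2).eq
  rw [pow_mul, ← unit_two_mul_self, sq, ← inv_eq_iff_mul_eq_one]
  exact h2

/-- The embedding of `Q₈` in Kuz'min's group. -/
def quaternionHom : QuaternionGroup 2 →* KuzminGroup :=
  QuaternionGroup.lift (unit 1) (unit 2) unit_one_pow unit_two_mul_self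
    unit_one_mul_unit_two_eq_mul_inv

@[simp]
theorem quaternionHom_a_one : quaternionHom (a 1) = unit 1 :=
  lift_a_one ..

@[simp]
theorem quaternionHom_xa_zero : quaternionHom (xa 0) = unit 2 :=
  lift_xa_zero ..

@[simp]
theorem quaternionHom_xa_three : quaternionHom (xa 3) = unit 3 := by
  rw [show (xa 3 : QuaternionGroup 2) = a 1 * xa 0 by decide, map_mul, quaternionHom_a_one,
    quaternionHom_xa_zero, unit_one_mul_unit_two]

theorem quaternionHom_rotate (q : QuaternionGroup 2) :
    quaternionHom (rotate q) = of 0 * quaternionHom q * (of 0)⁻¹ := by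
  have h : quaternionHom.comp rotate.toMonoidHom =
      (MulAut.conj (of 0)).toMonoidHom.comp quaternionHom := by
    apply QuaternionGroup.hom_ext
    · change quaternionHom (xa 3) = of 0 * quaternionHom (a 1) * (of 0)⁻¹
      simp [conj_unit_one]
    · change quaternionHom (a 1) = of 0 * quaternionHom (xa 0) * (of 0)⁻¹
      simp [conj_unit_two]
  exact DFunLike.congr_fun h q

/-- The homomorphism from `Q₈ ⋊ ℤ` to Kuz'min's group. -/
def ofSemidirect : QuaternionSemidirect →* KuzminGroup :=
  SemidirectProduct.lift quaternionHom (zpowersHom KuzminGroup (of 0))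
    (SemidirectProduct.conj_zpowersHom quaternionHom_rotate)

/-- The images in `Q₈ ⋊ ℤ` of the generators of Kuz'min's group. -/
def generator (i : Fin 4) : QuaternionSemidirect :=
  SemidirectProduct.inl (![1, a 1, xa 0, xa 3] i) *
    SemidirectProduct.inr (Multiplicative.ofAdd 1)

theorem generator_mul_eq {i j k : Fin 4}
    (h : (![1, a 1, xa 0, xa 3] : Fin 4 → QuaternionGroup 2) j *
        rotate ((![1, a 1, xa 0, xa 3] : Fin 4 → QuaternionGroup 2) i) =
      (![1, a 1, xa 0, xa 3] : Fin 4 → QuaternionGroup 2) i *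
        rotate ((![1, a 1, xa 0, xa 3] : Fin 4 → QuaternionGroup 2) k)) :
    (generator i)⁻¹ * generator j * generator i * (generator k)⁻¹ = 1 := by
  rw [mul_inv_eq_one, mul_assoc, inv_mul_eq_iff_eq_mul]
  ext
  · simpa [generator] using h
  · rfl

theorem lift_generator_eq_one : ∀ r ∈ kuzminRels, FreeGroup.lift generator r = 1 := by
  simp only [kuzminRels, Set.mem_insert_iff, Set.mem_singleton_iff, forall_eq_or_imp, forall_eq,
    map_mul, map_inv, FreeGroup.lift_apply_of]
  refine ⟨?_, ?_, ?_, ?_, ?_, ?_⟩ <;> exact generator_mul_eq (by decide)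

/-- The homomorphism from Kuz'min's group to `Q₈ ⋊ ℤ`. -/
def toSemidirect : KuzminGroup →* QuaternionSemidirect :=
  PresentedGroup.toGroup lift_generator_eq_one

@[simp]
theorem toSemidirect_of (i : Fin 4) : toSemidirect (of i) = generator i :=
  PresentedGroup.toGroup.of _

theorem ofSemidirect_generator (i : Fin 4) : ofSemidirect (generator i) = of i := by
  fin_cases i <;> simp [generator, ofSemidirect, unit]

/-- Kuz'min's group is `Q₈ ⋊ ℤ`. -/
def equivSemidirect : KuzminGroup ≃* QuaternionSemidirect :=
  MonoidHom.toMulEquiv toSemidirect ofSemidirect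
    (PresentedGroup.ext fun i => by
      change ofSemidirect (toSemidirect (of i)) = of i
      rw [toSemidirect_of, ofSemidirect_generator])
    (by
      apply SemidirectProduct.hom_ext
      · apply QuaternionGroup.hom_ext <;> simp [ofSemidirect, unit, generator]
      · ext
        simp [ofSemidirect, generator]
        simp [ofSemidirect, generator])

/-- The commutator subgroup of Kuz'min's group is `Q₈`. -/
noncomputable def commutatorEquiv : commutator KuzminGroup ≃* QuaternionGroup 2 :=
  ((equivSemidirect.subgroupMap (commutator KuzminGroup)).trans
    (MulEquiv.subgroupCongr (by
      have h : (⊤ : Subgroup KuzminGroup).map (equivSemidirect : _ →* QuaternionSemidirect) = ⊤ :=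
        Subgroup.map_top_of_surjective _ equivSemidirect.surjective
      rw [commutator_def, Subgroup.map_commutator, commutator_def, h]))).trans
    QuaternionSemidirect.commutatorEquiv

end KuzminGroup

/-- For Kuz'min's group `G`, the commutator subgroup `[G,G]` is a finite group of order
`8` isomorphic to the quaternion group `Q₈`, and `G` is isomorphic to a semidirect
product of `Q₈` with the infinite cyclic group generated by (the image of) `g`. -/
theorem kuzminGroup_structure :
    Nat.card (commutator KuzminGroup) = 8 ∧
    Nonempty (↥(commutator KuzminGroup) ≃* QuaternionGroup 2) ∧
    ∃ (φ : Multiplicative ℤ →* MulAut (QuaternionGroup 2))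
      (e : KuzminGroup ≃* QuaternionGroup 2 ⋊[φ] Multiplicative ℤ),
      e kuzminG = SemidirectProduct.inr (Multiplicative.ofAdd 1) := by
  refine ⟨?_, ⟨KuzminGroup.commutatorEquiv⟩, _, KuzminGroup.equivSemidirect, ?_⟩
  · rw [Nat.card_congr KuzminGroup.commutatorEquiv.toEquiv, Nat.card_eq_fintype_card,
      QuaternionGroup.card]
  · change KuzminGroup.toSemidirect (KuzminGroup.of 0) = _
    simp [KuzminGroup.generator]
end

section
/- Let G be the group presented with generators g, x, y, z and relations g⁻¹xg = y, g⁻¹yg = z, g⁻¹zg = x, y⁻¹gy = x, y⁻¹xy = z, y⁻¹zy = g. Then the centralizer C_G(g) of (the image of) g in G is infinite, while C_G(g) ∩ [G,G] is finite; in particular, C_G(g) ∩ [G,G] is a proper subgroup of C_G(g). -/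
open scoped commutatorElement in
/-- If a group is generated by a finite set which is stable under conjugation, then it has only
finitely many commutators. -/
theorem finite_commutatorSet_of_closure_eq_top {G : Type*} [Group G] {S : Set G} (hS : S.Finite)
    (hgen : Subgroup.closure S = ⊤) (hconj : ∀ h : G, ∀ s ∈ S, h * s * h⁻¹ ∈ S) :
    Finite (commutatorSet G) := by
  have : Finite S := hS
  let Φ : G → S → S := fun h s => ⟨h * s * h⁻¹, hconj h s s.2⟩
  have center_of_eq : ∀ a b, Φ a = Φ b → a⁻¹ * b ∈ Subgroup.center G := by
    intro a b hab
    rw [← Subgroup.centralizer_univ, ← Subgroup.coe_top, ← hgen, Subgroup.centralizer_closure,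
      Subgroup.mem_centralizer_iff]
    intro s hs
    have h : a * s * a⁻¹ = b * s * b⁻¹ := congrArg Subtype.val (congrFun hab ⟨s, hs⟩)
    calc s * (a⁻¹ * b) = a⁻¹ * (a * s * a⁻¹) * b := by group
      _ = a⁻¹ * b * s := by rw [h]; group
  have factors : Function.FactorsThrough (fun p : G × G => ⁅p.1, p.2⁆)
      (fun p => (Φ p.1, Φ p.2)) := by
    rintro ⟨a, b⟩ ⟨a', b'⟩ h
    obtain ⟨h₁, h₂⟩ := Prod.mk.inj h
    obtain ⟨c, hc, rfl⟩ : ∃ c ∈ Subgroup.center G, a' = a * c :=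
      ⟨_, center_of_eq _ _ h₁, by group⟩
    obtain ⟨d, hd, rfl⟩ : ∃ d ∈ Subgroup.center G, b' = b * d :=
      ⟨_, center_of_eq _ _ h₂, by group⟩
    rw [Subgroup.mem_center_iff] at hc hd
    change ⁅a, b⁆ = ⁅a * c, b * d⁆
    symm
    calc ⁅a * c, b * d⁆ = a * (c * (b * d)) * (c⁻¹ * a⁻¹) * (b * d)⁻¹ := by
          simp only [commutatorElement_def]; group
      _ = a * b * (d * a⁻¹) * d⁻¹ * b⁻¹ := by rw [← hc]; group
      _ = ⁅a, b⁆ := by rw [← hd, commutatorElement_def]; group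
  obtain ⟨e, he⟩ := (Function.factorsThrough_iff _).1 factors
  have : commutatorSet G = Set.range (fun p : G × G => ⁅p.1, p.2⁆) := by
    ext; simp [mem_commutatorSet_iff]
  rw [this, he]
  exact ((Set.finite_range e).subset (Set.range_comp_subset_range _ _)).to_subtype

namespace KuzminGroup

/-- The image in Kuz'min's group of the `i`-th generator. -/
def gen (i : Fin 4) : KuzminGroup :=
  PresentedGroup.of (rels := kuzminRels) i

theorem closure_range_gen : Subgroup.closure (Set.range gen) = ⊤ :=
  PresentedGroup.closure_range_of kuzminRels

theorem conj_gen_eq {i j k : Fin 4} (h : (FreeGroup.of i)⁻¹ * FreeGroup.of j * FreeGroup.of i *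
    (FreeGroup.of k)⁻¹ ∈ kuzminRels) : (gen i)⁻¹ * gen j * gen i = gen k :=
  mul_inv_eq_one.1 (PresentedGroup.one_of_mem h)

theorem gen_zero_conj :
    (gen 0)⁻¹ * gen 1 * gen 0 = gen 2 ∧ (gen 0)⁻¹ * gen 2 * gen 0 = gen 3 ∧
      (gen 0)⁻¹ * gen 3 * gen 0 = gen 1 := by
  refine ⟨conj_gen_eq ?_, conj_gen_eq ?_, conj_gen_eq ?_⟩ <;> simp [kuzminRels]

theorem gen_two_conj :
    (gen 2)⁻¹ * gen 0 * gen 2 = gen 1 ∧ (gen 2)⁻¹ * gen 1 * gen 2 = gen 3 ∧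
      (gen 2)⁻¹ * gen 3 * gen 2 = gen 0 := by
  refine ⟨conj_gen_eq ?_, conj_gen_eq ?_, conj_gen_eq ?_⟩ <;> simp [kuzminRels]

theorem mem_of_gen_mem {H : Subgroup KuzminGroup} (h₀ : gen 0 ∈ H) (h₂ : gen 2 ∈ H)
    (h : KuzminGroup) : h ∈ H := by
  have h₁ : gen 1 ∈ H := by
    rw [← gen_two_conj.1]; exact H.mul_mem (H.mul_mem (H.inv_mem h₂) h₀) h₂
  have h₃ : gen 3 ∈ H := by
    rw [← gen_zero_conj.2.1]; exact H.mul_mem (H.mul_mem (H.inv_mem h₀) h₂) h₀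
  have : (⊤ : Subgroup KuzminGroup) ≤ H := by
    rw [← closure_range_gen, Subgroup.closure_le]
    rintro _ ⟨i, rfl⟩
    fin_cases i <;> assumption
  exact this (Subgroup.mem_top h)

/-- An element which conjugates the generators according to a permutation normalizes the set
of generators. -/
theorem mem_normalizer_of_perm {h : KuzminGroup} (σ : Equiv.Perm (Fin 4))
    (hσ : ∀ i, h⁻¹ * gen i * h = gen (σ i)) : h ∈ Subgroup.normalizer (Set.range gen) := by
  rw [← inv_mem_iff, Subgroup.mem_set_normalizer_iff]
  intro n
  rw [inv_inv]
  constructor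
  · rintro ⟨i, rfl⟩
    exact ⟨σ i, (hσ i).symm⟩
  · rintro ⟨i, hi⟩
    refine ⟨σ.symm i, ?_⟩
    have := hσ (σ.symm i)
    rw [σ.apply_symm_apply, hi] at this
    exact mul_left_cancel (mul_right_cancel this)

theorem mem_normalizer (h : KuzminGroup) : h ∈ Subgroup.normalizer (Set.range gen) := by
  refine mem_of_gen_mem (mem_normalizer_of_perm (c[1, 2, 3]) fun i => ?_)
    (mem_normalizer_of_perm (c[0, 1, 3]) fun i => ?_) h
  · obtain ⟨h₁, h₂, h₃⟩ := gen_zero_conj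
    fin_cases i
    · exact mul_assoc _ _ _ |>.trans (inv_mul_cancel_left _ _)
    exacts [h₁, h₂, h₃]
  · obtain ⟨h₀, h₁, h₃⟩ := gen_two_conj
    fin_cases i
    · exact h₀
    · exact h₁
    · exact mul_assoc _ _ _ |>.trans (inv_mul_cancel_left _ _)
    · exact h₃

instance finite_commutatorSet : Finite (commutatorSet KuzminGroup) :=
  finite_commutatorSet_of_closure_eq_top (Set.finite_range gen) closure_range_gen fun h s hs =>
    (Subgroup.mem_set_normalizer_iff.1 (mem_normalizer h) s).1 hs

/-- The homomorphism to the infinite cyclic group sending every generator to a fixed one. -/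
def degree : KuzminGroup →* Multiplicative ℤ :=
  PresentedGroup.toGroup (rels := kuzminRels) (f := fun _ => Multiplicative.ofAdd 1) (by
    rintro r (rfl | rfl | rfl | rfl | rfl | rfl) <;> simp)

theorem degree_kuzminG : degree kuzminG = Multiplicative.ofAdd 1 :=
  PresentedGroup.toGroup.of _

theorem injective_kuzminG_pow : Function.Injective fun n : ℕ => kuzminG ^ n := by
  intro m n h
  have := congrArg (fun a => (degree a).toAdd) h
  simpa [degree_kuzminG] using this

end KuzminGroup

/-- For Kuz'min's group `G`, the centralizer `C_G(g)` is infinite while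
`C_G(g) ∩ [G,G]` is finite; in particular `C_G(g) ∩ [G,G]` is a proper subgroup of
`C_G(g)`. -/
theorem kuzminGroup_centralizer :
    (Subgroup.centralizer {kuzminG} : Set KuzminGroup).Infinite ∧
    ((Subgroup.centralizer {kuzminG} ⊓ commutator KuzminGroup : Subgroup KuzminGroup)
      : Set KuzminGroup).Finite ∧
    Subgroup.centralizer {kuzminG} ⊓ commutator KuzminGroup
      < Subgroup.centralizer {kuzminG} := by
  have infinite : (Subgroup.centralizer {kuzminG} : Set KuzminGroup).Infinite :=
    Set.infinite_of_injective_forall_mem KuzminGroup.injective_kuzminG_pow fun n =>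
      pow_mem (Subgroup.mem_centralizer_singleton_iff.2 rfl) n
  have finite : ((Subgroup.centralizer {kuzminG} ⊓ commutator KuzminGroup :
      Subgroup KuzminGroup) : Set KuzminGroup).Finite :=
    Set.Finite.subset (inferInstanceAs (Finite (commutator KuzminGroup))) Set.inter_subset_right
  exact ⟨infinite, finite, lt_of_le_of_ne inf_le_left fun h => infinite (h ▸ finite)⟩
end

section
/- Let G be the group presented with generators g, x, y, z and relations g⁻¹xg = y, g⁻¹yg = z, g⁻¹zg = x, y⁻¹gy = x, y⁻¹xy = z, y⁻¹zy = g. Then G coincides with the normal closure of (the image of) g, and the class of g generates the abelianization G_ab ≅ ℤ. -/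
/-- Every generator of Kuz'min's group is conjugate to `g`. -/
theorem isConj_kuzminG_of (j : Fin 4) :
    IsConj (α := KuzminGroup) kuzminG (PresentedGroup.of (rels := kuzminRels) j) := by
  have conj_of_rel (i k l : Fin 4) (h : (FreeGroup.of k)⁻¹ * FreeGroup.of i * FreeGroup.of k *
      (FreeGroup.of l)⁻¹ ∈ kuzminRels) :
      IsConj (PresentedGroup.of (rels := kuzminRels) i) (PresentedGroup.of l) := by
    refine isConj_iff.2 ⟨(PresentedGroup.of k)⁻¹, ?_⟩
    rw [inv_inv]
    simpa only [map_mul, map_inv, PresentedGroup.of] using PresentedGroup.mk_eq_mk_of_mul_inv_mem h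
  have hx := conj_of_rel 0 2 1 (by simp [kuzminRels])
  have hy := conj_of_rel 1 0 2 (by simp [kuzminRels])
  have hz := conj_of_rel 1 2 3 (by simp [kuzminRels])
  fin_cases j
  · exact IsConj.refl _
  · exact hx
  · exact hx.trans hy
  · exact hx.trans hz

/-- Two homomorphisms from Kuz'min's group to a commutative group agree if they agree at `g`. -/
theorem KuzminGroup.hom_ext {A : Type*} [CommGroup A] {φ ψ : KuzminGroup →* A}
    (h : φ kuzminG = ψ kuzminG) : φ = ψ := by
  refine PresentedGroup.ext (rels := kuzminRels) fun j => ?_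
  have hφ := isConj_iff_eq.1 (φ.map_isConj (isConj_kuzminG_of j))
  have hψ := isConj_iff_eq.1 (ψ.map_isConj (isConj_kuzminG_of j))
  exact hφ.symm.trans (h.trans hψ)

/-- The homomorphism from Kuz'min's group to `ℤ` that sends every generator to `1`. -/
def KuzminGroup.degree_s17 : KuzminGroup →* Multiplicative ℤ :=
  PresentedGroup.toGroup (rels := kuzminRels) (f := fun _ => Multiplicative.ofAdd 1) <| by
    rintro r (rfl | rfl | rfl | rfl | rfl | rfl) <;> simp

theorem KuzminGroup.degree_kuzminG_s17 : KuzminGroup.degree_s17 kuzminG = Multiplicative.ofAdd 1 :=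
  PresentedGroup.toGroup.of _

/-- The abelianization of Kuz'min's group is infinite cyclic. -/
def KuzminGroup.abelianizationEquiv : Abelianization KuzminGroup ≃* Multiplicative ℤ :=
  MonoidHom.toMulEquiv (Abelianization.lift KuzminGroup.degree_s17)
    (zpowersHom _ (Abelianization.of kuzminG))
    (Abelianization.hom_ext _ _ <| KuzminGroup.hom_ext <| by
      simp [KuzminGroup.degree_kuzminG_s17])
    (MonoidHom.ext_mint <| by simp [KuzminGroup.degree_kuzminG_s17])

/-- Kuz'min's group `G` coincides with the normal closure of (the image of) `g`, and
the class of `g` generates the abelianization `G_ab ≅ ℤ`. -/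
theorem kuzminGroup_normalClosure_abelianization :
    Subgroup.normalClosure {kuzminG} = (⊤ : Subgroup KuzminGroup) ∧
    ∃ e : Additive (Abelianization KuzminGroup) ≃+ ℤ,
      e (Additive.ofMul (Abelianization.of kuzminG)) = 1 := by
  refine ⟨?_, KuzminGroup.abelianizationEquiv.toAdditiveLeft, ?_⟩
  · refine (Subgroup.eq_top_iff' _).2 fun a =>
      PresentedGroup.generated_by kuzminRels (Subgroup.normalClosure {kuzminG}) (fun j => ?_) a
    obtain ⟨c, hc⟩ := isConj_iff.1 (isConj_kuzminG_of j)
    have := Subgroup.normalClosure_normal.conj_mem kuzminG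
      (Subgroup.subset_normalClosure (Set.mem_singleton kuzminG)) c
    rw [hc] at this
    exact this
  · exact congrArg Multiplicative.toAdd KuzminGroup.degree_kuzminG_s17
end
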